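/- arXiv:1606.08413 — 2 statements merged into one kernel-verified Lean document; each statement's English description precedes it below -/
import Mathlib

section
/- Let T be a tensor triangulated category whose unit object 1 is compact and which is compactly generated by the single object 1 (i.e., every object x with Hom(1[n], x) = 0 for all n ∈ ℤ is zero). Then every localizing subcategory of T is a tensor ideal of T: if C ⊆ T is localizing, c ∈ C, and t ∈ T, then t ⊗ c ∈ C. -/
open CategoryTheory Category Limits Pretriangulated ZeroObject MonoidalCategory

universe v u u₂

namespace Paper

variable {C : Type u} [Category.{v} C] [Preadditive C] [HasZeroObject C] [HasShift C ℤ]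
  [∀ n : ℤ, (shiftFunctor C n).Additive] [Pretriangulated C] [IsTriangulated C]
  [HasCoproducts.{v} C]

variable [MonoidalCategory C] [SymmetricCategory C]
  [∀ X : C, (tensorLeft X).CommShift ℤ]
  [∀ X : C, (tensorRight X).CommShift ℤ]
  [∀ X : C, (tensorLeft X).IsTriangulated]
  [∀ X : C, (tensorRight X).IsTriangulated]
  [∀ (X : C) (ι : Type v), PreservesColimitsOfShape (Discrete ι) (tensorLeft X)]
  [∀ (X : C) (ι : Type v), PreservesColimitsOfShape (Discrete ι) (tensorRight X)]

/-- A (full, replete) triangulated subcategory, encoded as its set of objects: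
it contains a zero object, is closed under isomorphisms, and satisfies two-out-of-three
for distinguished triangles. -/
structure IsTriangulatedSub {E : Type*} [Category E] [Preadditive E] [HasZeroObject E]
    [HasShift E ℤ] [∀ n : ℤ, (shiftFunctor E n).Additive] [Pretriangulated E]
    (S : Set E) : Prop where
  zero_mem : (0 : E) ∈ S
  iso_closed : ∀ ⦃X Y : E⦄, (X ≅ Y) → X ∈ S → Y ∈ S
  two_of_three₃ : ∀ T, (T ∈ distTriang E) → T.obj₁ ∈ S → T.obj₂ ∈ S → T.obj₃ ∈ S
  two_of_three₂ : ∀ T, (T ∈ distTriang E) → T.obj₁ ∈ S → T.obj₃ ∈ S → T.obj₂ ∈ S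
  two_of_three₁ : ∀ T, (T ∈ distTriang E) → T.obj₂ ∈ S → T.obj₃ ∈ S → T.obj₁ ∈ S

/-- A localizing subcategory: a triangulated subcategory closed under small coproducts. -/
def IsLocalizing (S : Set C) : Prop :=
  IsTriangulatedSub S ∧ ∀ {ι : Type v} (x : ι → C), (∀ i, x i ∈ S) → (∐ x) ∈ S

/-- `⟨A⟩`: the smallest localizing subcategory containing the class `A`. -/
def localizingGen (A : Set C) : Set C :=
  ⋂₀ {S : Set C | IsLocalizing S ∧ A ⊆ S}

/-- The canonical comparison map `⊕ᵢ Hom(t, x i) →+ Hom(t, ∐ x)` sending the `i`-th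
component `g` to `g ≫ Sigma.ι x i`. -/
noncomputable def coproductComparison (t : C) {ι : Type v} (x : ι → C) :
    (DirectSum ι fun i => (t ⟶ x i)) →+ (t ⟶ ∐ x) :=
  letI : DecidableEq ι := Classical.decEq ι
  DirectSum.toAddMonoid fun i =>
    AddMonoidHom.mk' (fun g => g ≫ Sigma.ι x i) fun _ _ => Preadditive.add_comp _ _ _ _ _ _

/-- An object `t` is compact if for every small family `x` the canonical map
`⊕ᵢ Hom(t, x i) → Hom(t, ∐ x)` is bijective. -/
def IsCompactObj (t : C) : Prop :=
  ∀ {ι : Type v} (x : ι → C), Function.Bijective (coproductComparison t x)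

variable (C) in
/-- The class `T^c` of compact objects. -/
def compacts : Set C := {t : C | IsCompactObj t}

variable (C) in
/-- `T` is compactly generated: there is a set of compact objects `G` such that any object
receiving no nonzero maps from shifts of objects of `G` is zero. -/
def IsCompactlyGenerated : Prop :=
  ∃ G : Set C, (∀ g ∈ G, IsCompactObj g) ∧
    ∀ x : C, (∀ g ∈ G, ∀ n : ℤ, ∀ f : (g⟦n⟧ ⟶ x), f = 0) → IsZero x

section

variable {T : Type u} [Category.{v} T] [Preadditive T] [HasShift T ℤ]
  [∀ n : ℤ, (shiftFunctor T n).Additive]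

lemma eq_zero_of_comp_shift_map {t Y Z : T} {d : Y ⟶ Z}
    (h : ∀ (k : ℤ) (g : t⟦k⟧ ⟶ Y), g ≫ d = 0 → g = 0) (k : ℤ) (f : t⟦k⟧ ⟶ Y⟦(1 : ℤ)⟧)
    (hf : f ≫ d⟦(1 : ℤ)⟧' = 0) : f = 0 := by
  let e := (shiftFunctorAdd' T (k - 1) 1 k (by lia)).app t
  obtain ⟨g, hg⟩ := (shiftFunctor T (1 : ℤ)).map_surjective (e.inv ≫ f)
  have hg₀ : g = 0 := h _ g <| (shiftFunctor T (1 : ℤ)).map_injective <| by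
    rw [Functor.map_comp, hg, assoc, hf, comp_zero, Functor.map_zero]
  rw [hg₀, Functor.map_zero] at hg
  rw [← cancel_epi e.inv, ← hg, comp_zero]

variable [HasZeroObject T] [Pretriangulated T]

lemma IsTriangulatedSub.shift_mem {S : Set T} (hS : IsTriangulatedSub S) {X : T} (hX : X ∈ S)
    (n : ℤ) : X⟦n⟧ ∈ S := by
  have h_shift (Y : T) : Y⟦(1 : ℤ)⟧ ∈ S ↔ Y ∈ S :=
    ⟨fun h => hS.two_of_three₁ _ (contractible_distinguished₂ Y) hS.zero_mem h,
      fun h => hS.two_of_three₃ _ (contractible_distinguished₂ Y) h hS.zero_mem⟩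
  induction n using Int.induction_on with
  | zero => exact hS.iso_closed ((shiftFunctorZero T ℤ).symm.app X) hX
  | succ n ih =>
    exact hS.iso_closed ((shiftFunctorAdd' T (n : ℤ) 1 _ rfl).symm.app X) ((h_shift _).2 ih)
  | pred n ih =>
    rw [← h_shift]
    exact hS.iso_closed ((shiftFunctorAdd' T (-(n : ℤ) - 1) 1 (-n) (by lia)).app X) ih

end

section

variable {T : Type u} [Category.{v} T] [Preadditive T] [HasCoproducts.{v} T]

/-- The subgroup of `Hom(t, ∐ x)` generated by the morphisms factoring through a summand. -/
noncomputable def summandSubgroup (t : T) {ι : Type v} (x : ι → T) : AddSubgroup (t ⟶ ∐ x) :=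
  AddSubgroup.closure {f | ∃ (i : ι) (g : t ⟶ x i), g ≫ Sigma.ι x i = f}

lemma comp_ι_mem_summandSubgroup {t : T} {ι : Type v} {x : ι → T} {i : ι} (g : t ⟶ x i) :
    g ≫ Sigma.ι x i ∈ summandSubgroup t x :=
  AddSubgroup.subset_closure ⟨i, g, rfl⟩

lemma IsCompactObj.mem_summandSubgroup {t : T} (ht : IsCompactObj t) {ι : Type v} {x : ι → T}
    (f : t ⟶ ∐ x) : f ∈ summandSubgroup t x := by
  classical
  obtain ⟨z, rfl⟩ := (ht x).2 f
  induction z using DirectSum.induction_on with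
  | zero => rw [map_zero]; exact zero_mem _
  | of i g =>
    convert comp_ι_mem_summandSubgroup g
    simp only [coproductComparison]
    erw [DirectSum.toAddMonoid_of]
    rfl
  | add a b ha hb => rw [map_add]; exact add_mem ha hb

lemma mem_summandSubgroup_shift [HasShift T ℤ] [∀ n : ℤ, (shiftFunctor T n).Additive] {t : T}
    (ht : ∀ {ι : Type v} {x : ι → T} (f : t ⟶ ∐ x), f ∈ summandSubgroup t x) (n : ℤ)
    {ι : Type v} {x : ι → T} (f : t⟦n⟧ ⟶ ∐ x) : f ∈ summandSubgroup (t⟦n⟧) x := by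
  let adj : shiftFunctor T n ⊣ shiftFunctor T (-n) := (shiftEquiv T n).toAdjunction
  let e := PreservesCoproduct.iso (shiftFunctor T (-n)) x
  suffices H : ∀ h : t ⟶ ∐ fun i => (x i)⟦-n⟧,
      (adj.homAddEquiv t (∐ x)).symm (h ≫ e.inv) ∈ summandSubgroup (t⟦n⟧) x by
    simpa using H (adj.homAddEquiv t (∐ x) f ≫ e.hom)
  intro h
  induction ht h using AddSubgroup.closure_induction with
  | mem h hh =>
    obtain ⟨i, g, rfl⟩ := hh
    have : (adj.homAddEquiv t (∐ x)).symm ((g ≫ Sigma.ι (fun i => (x i)⟦-n⟧) i) ≫ e.inv) =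
        (adj.homEquiv _ _).symm g ≫ Sigma.ι x i := by
      rw [← adj.homEquiv_naturality_right_symm, assoc, PreservesCoproduct.inv_hom,
        ι_comp_sigmaComparison]
      rfl
    rw [this]
    exact comp_ι_mem_summandSubgroup _
  | zero => simp
  | add a b _ _ ha hb => simpa using add_mem ha hb
  | neg a _ ha => simpa using ha

lemma eq_zero_of_comp_π_eq_zero {t : T} {ι : Type v} [DecidableEq ι] {x : ι → T} {f : t ⟶ ∐ x}
    (hf : f ∈ summandSubgroup t x) (h : ∀ i, f ≫ Sigma.π x i = 0) : f = 0 := by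
  suffices H : ∃ s : Finset ι, ∀ s', s ⊆ s' →
      f = ∑ i ∈ s', (f ≫ Sigma.π x i) ≫ Sigma.ι x i by
    obtain ⟨s, hs⟩ := H
    rw [hs s subset_rfl]
    exact Finset.sum_eq_zero fun i _ => by rw [h, zero_comp]
  clear h
  induction hf using AddSubgroup.closure_induction with
  | mem f hf =>
    obtain ⟨i, g, rfl⟩ := hf
    refine ⟨{i}, fun s' hs' => ?_⟩
    rw [Finset.sum_eq_single i]
    · simp
    · intro j _ hj
      rw [assoc g, Sigma.ι_π_of_ne _ hj.symm, comp_zero, zero_comp]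
    · intro hi
      exact absurd (Finset.singleton_subset_iff.1 hs') hi
  | zero => exact ⟨∅, by simp⟩
  | add a b _ _ ha hb =>
    obtain ⟨s, hs⟩ := ha
    obtain ⟨s₂, hs₂⟩ := hb
    refine ⟨s ∪ s₂, fun s' hs' => ?_⟩
    simp only [Preadditive.add_comp, Finset.sum_add_distrib]
    rw [← hs s' (Finset.union_subset_left hs'), ← hs₂ s' (Finset.union_subset_right hs')]
  | neg a _ ha =>
    obtain ⟨s, hs⟩ := ha
    refine ⟨s, fun s' hs' => ?_⟩
    simp only [Preadditive.neg_comp, Finset.sum_neg_distrib]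
    rw [← hs s' hs']

section Telescope

variable {F : ℕ → T} (φ : ∀ n, F n ⟶ F (n + 1))

/-- The map `1 - shift` on the coproduct of a sequence, whose cone is the homotopy colimit. -/
noncomputable def oneSubShift :
    (∐ fun i : ULift.{v} ℕ => F i.down) ⟶ ∐ fun i : ULift.{v} ℕ => F i.down :=
  𝟙 _ - Limits.Sigma.desc fun i : ULift.{v} ℕ =>
    φ i.down ≫ Sigma.ι (fun i : ULift.{v} ℕ => F i.down) ⟨i.down + 1⟩

lemma ι_oneSubShift (n : ℕ) :
    Sigma.ι (fun i : ULift.{v} ℕ => F i.down) ⟨n⟩ ≫ oneSubShift φ =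
      Sigma.ι (fun i : ULift.{v} ℕ => F i.down) ⟨n⟩ -
        φ n ≫ Sigma.ι (fun i : ULift.{v} ℕ => F i.down) ⟨n + 1⟩ := by
  simp [oneSubShift]

lemma oneSubShift_π_zero :
    oneSubShift φ ≫ Sigma.π (fun i : ULift.{v} ℕ => F i.down) ⟨0⟩ =
      Sigma.π (fun i : ULift.{v} ℕ => F i.down) ⟨0⟩ := by
  refine Sigma.hom_ext _ _ fun ⟨n⟩ => ?_
  rw [reassoc_of% ι_oneSubShift φ n, Preadditive.sub_comp, assoc,
    Sigma.ι_π_of_ne (fun i : ULift.{v} ℕ => F i.down) (b := ⟨n + 1⟩) (c := ⟨0⟩) (by simp),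
    comp_zero, sub_zero]

lemma oneSubShift_π_succ (m : ℕ) :
    oneSubShift φ ≫ Sigma.π (fun i : ULift.{v} ℕ => F i.down) ⟨m + 1⟩ =
      Sigma.π (fun i : ULift.{v} ℕ => F i.down) ⟨m + 1⟩ -
        Sigma.π (fun i : ULift.{v} ℕ => F i.down) ⟨m⟩ ≫ φ m := by
  refine Sigma.hom_ext _ _ fun ⟨n⟩ => ?_
  rw [reassoc_of% ι_oneSubShift φ n, Preadditive.sub_comp, assoc, Preadditive.comp_sub]
  congr 1
  by_cases h : n = m
  · subst h
    rw [Sigma.ι_π_eq_id_assoc, Sigma.ι_π_eq_id, comp_id]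
  · rw [Sigma.ι_π_of_ne _ (by simpa using h), Sigma.ι_π_of_ne_assoc _ (by simpa using h),
      comp_zero, zero_comp]

lemma eq_zero_of_comp_oneSubShift {t : T} {f : t ⟶ ∐ fun i : ULift.{v} ℕ => F i.down}
    (hf : f ∈ summandSubgroup t _) (h : f ≫ oneSubShift φ = 0) : f = 0 := by
  refine eq_zero_of_comp_π_eq_zero hf ?_
  rintro ⟨n⟩
  induction n with
  | zero => rw [← oneSubShift_π_zero φ, reassoc_of% h, zero_comp]
  | succ n ih =>
    have := f ≫= oneSubShift_π_succ φ n
    rw [reassoc_of% h, zero_comp, Preadditive.comp_sub, reassoc_of% ih, zero_comp, sub_zero] at this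
    exact this.symm

lemma ι_comp_eq {Y : T} {q : (∐ fun i : ULift.{v} ℕ => F i.down) ⟶ Y}
    (hq : oneSubShift φ ≫ q = 0) (n : ℕ) :
    Sigma.ι (fun i : ULift.{v} ℕ => F i.down) ⟨n⟩ ≫ q =
      φ n ≫ Sigma.ι (fun i : ULift.{v} ℕ => F i.down) ⟨n + 1⟩ ≫ q := by
  have := ι_oneSubShift φ n =≫ q
  rwa [assoc, hq, comp_zero, Preadditive.sub_comp, assoc, eq_comm, sub_eq_zero] at this

/-- A morphism to a homotopy colimit that lifts to finitely many stages factors through one. -/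
lemma exists_factor_of_mem_summandSubgroup {t Y : T}
    {q : (∐ fun i : ULift.{v} ℕ => F i.down) ⟶ Y} (hq : oneSubShift φ ≫ q = 0)
    {f : t ⟶ ∐ fun i : ULift.{v} ℕ => F i.down} (hf : f ∈ summandSubgroup t _) :
    ∃ n, ∃ g : t ⟶ F n, f ≫ q = g ≫ Sigma.ι (fun i : ULift.{v} ℕ => F i.down) ⟨n⟩ ≫ q := by
  suffices H : ∃ n, ∀ m, n ≤ m → ∃ g : t ⟶ F m,
      f ≫ q = g ≫ Sigma.ι (fun i : ULift.{v} ℕ => F i.down) ⟨m⟩ ≫ q by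
    obtain ⟨n, hn⟩ := H
    exact ⟨n, hn n le_rfl⟩
  induction hf using AddSubgroup.closure_induction with
  | mem f hf =>
    obtain ⟨⟨n⟩, g, rfl⟩ := hf
    refine ⟨n, fun m hm => ?_⟩
    induction m, hm using Nat.le_induction with
    | base => exact ⟨g, assoc _ _ _⟩
    | succ m _ ih =>
      obtain ⟨g', hg'⟩ := ih
      exact ⟨g' ≫ φ m, by rw [hg', ι_comp_eq φ hq, assoc]⟩
  | zero => exact ⟨0, fun m _ => ⟨0, by simp⟩⟩
  | add a b _ _ ha hb =>
    obtain ⟨n, hn⟩ := ha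
    obtain ⟨n', hn'⟩ := hb
    refine ⟨max n n', fun m hm => ?_⟩
    obtain ⟨g, hg⟩ := hn m (le_of_max_le_left hm)
    obtain ⟨g', hg'⟩ := hn' m (le_of_max_le_right hm)
    exact ⟨g + g', by rw [Preadditive.add_comp, Preadditive.add_comp, hg, hg']⟩
  | neg a _ ha =>
    obtain ⟨n, hn⟩ := ha
    refine ⟨n, fun m hm => ?_⟩
    obtain ⟨g, hg⟩ := hn m hm
    exact ⟨-g, by rw [Preadditive.neg_comp, Preadditive.neg_comp, hg]⟩

end Telescope

variable [HasZeroObject T] [HasShift T ℤ] [∀ n : ℤ, (shiftFunctor T n).Additive]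
  [Pretriangulated T]

lemma IsLocalizing.exists_factor_killing {S : Set T} (hS : IsLocalizing S) {t : T} (ht : t ∈ S)
    {F x : T} (hF : F ∈ S) (p : F ⟶ x) :
    ∃ F' ∈ S, ∃ (φ : F ⟶ F') (p' : F' ⟶ x), φ ≫ p' = p ∧
      ∀ (k : ℤ) (g : t⟦k⟧ ⟶ F), g ≫ p = 0 → g ≫ φ = 0 := by
  let d : (∐ fun i : Σ k : ℤ, {g : t⟦k⟧ ⟶ F // g ≫ p = 0} => t⟦i.1⟧) ⟶ F :=
    Limits.Sigma.desc fun i => i.2.1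
  obtain ⟨F', φ, δ, hT⟩ := distinguished_cocone_triangle d
  have hdp : d ≫ p = 0 := Sigma.hom_ext _ _ fun i => by simpa [d] using i.2.2
  obtain ⟨p', hp'⟩ := Triangle.yoneda_exact₂ _ hT p hdp
  refine ⟨F', hS.1.two_of_three₃ _ hT (hS.2 _ fun i => hS.1.shift_mem ht _) hF, φ, p', hp'.symm,
    fun k g hg => ?_⟩
  have hg' : g = Sigma.ι (fun i : Σ k : ℤ, {g : t⟦k⟧ ⟶ F // g ≫ p = 0} => t⟦i.1⟧)
      ⟨k, g, hg⟩ ≫ d := by simp [d]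
  have hdφ : d ≫ φ = 0 := comp_distTriang_mor_zero₁₂ _ hT
  rw [hg', assoc, hdφ, comp_zero]

/-- A localizing subcategory containing a compact generator is everything. -/
theorem IsLocalizing.mem_of_compact_generator {S : Set T} (hS : IsLocalizing S) {t : T}
    (ht : t ∈ S) (htc : IsCompactObj t)
    (hgen : ∀ x : T, (∀ n : ℤ, ∀ f : t⟦n⟧ ⟶ x, f = 0) → IsZero x) (x : T) : x ∈ S := by
  have hsmall (k : ℤ) {ι : Type v} {y : ι → T} (f : t⟦k⟧ ⟶ ∐ y) :
      f ∈ summandSubgroup (t⟦k⟧) y :=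
    mem_summandSubgroup_shift (fun f => htc.mem_summandSubgroup f) k f
  have hstep (p : {p : Over x // p.left ∈ S}) : ∃ (p' : {p : Over x // p.left ∈ S})
      (φ : p.1.left ⟶ p'.1.left), φ ≫ p'.1.hom = p.1.hom ∧
        ∀ (k : ℤ) (g : t⟦k⟧ ⟶ p.1.left), g ≫ p.1.hom = 0 → g ≫ φ = 0 := by
    obtain ⟨F', hF', φ, p', h⟩ := hS.exists_factor_killing ht p.2 p.1.hom
    exact ⟨⟨Over.mk p', hF'⟩, φ, h⟩
  choose next φ hφ hkill using hstep
  let p₀ : {p : Over x // p.left ∈ S} :=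
    ⟨Over.mk (Y := ∐ fun i : Σ k : ℤ, (t⟦k⟧ ⟶ x) => t⟦i.1⟧) (Limits.Sigma.desc fun i => i.2),
      hS.2 _ fun i => hS.1.shift_mem ht _⟩
  let p : ℕ → {p : Over x // p.left ∈ S} := fun n => Nat.rec p₀ (fun _ => next) n
  let F : ℕ → T := fun n => (p n).1.left
  let ψ : ∀ n, F n ⟶ F (n + 1) := fun n => φ (p n)
  have hψ (n : ℕ) : ψ n ≫ (p (n + 1)).1.hom = (p n).1.hom := hφ (p n)
  obtain ⟨Y, q, δ, hT⟩ := distinguished_cocone_triangle (oneSubShift ψ)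
  have hq : oneSubShift ψ ≫ q = 0 := comp_distTriang_mor_zero₁₂ _ hT
  have hYS : Y ∈ S := by
    have hsum : (∐ fun i : ULift.{v} ℕ => F i.down) ∈ S := hS.2 _ fun i => (p i.down).2
    exact hS.1.two_of_three₃ _ hT hsum hsum
  let P : (∐ fun i : ULift.{v} ℕ => F i.down) ⟶ x :=
    Limits.Sigma.desc fun i : ULift.{v} ℕ => (p i.down).1.hom
  have hP (n : ℕ) : Sigma.ι (fun i : ULift.{v} ℕ => F i.down) ⟨n⟩ ≫ P = (p n).1.hom := by
    simp [P]
  have hdP : oneSubShift ψ ≫ P = 0 := by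
    refine Sigma.hom_ext _ _ fun ⟨n⟩ => ?_
    rw [reassoc_of% ι_oneSubShift ψ n, Preadditive.sub_comp, assoc, hP, hP, hψ, sub_self, comp_zero]
  obtain ⟨h, hqh⟩ : ∃ h : Y ⟶ x, P = q ≫ h := Triangle.yoneda_exact₂ _ hT P hdP
  have hsurj (k : ℤ) (f : t⟦k⟧ ⟶ x) : ∃ g : t⟦k⟧ ⟶ Y, f = g ≫ h := by
    refine ⟨Sigma.ι (fun i : Σ k : ℤ, (t⟦k⟧ ⟶ x) => t⟦i.1⟧) ⟨k, f⟩ ≫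
      Sigma.ι (fun i : ULift.{v} ℕ => F i.down) ⟨0⟩ ≫ q, ?_⟩
    rw [assoc, assoc, ← hqh, hP]
    simp [p, p₀]
  have hinj (k : ℤ) (f : t⟦k⟧ ⟶ Y) (hf : f ≫ h = 0) : f = 0 := by
    have hfδ : f ≫ δ = 0 := by
      refine eq_zero_of_comp_shift_map (d := oneSubShift ψ)
        (fun k g hg => eq_zero_of_comp_oneSubShift ψ (hsmall k g) hg) k _ ?_
      have : δ ≫ (oneSubShift ψ)⟦(1 : ℤ)⟧' = 0 := comp_distTriang_mor_zero₃₁ _ hT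
      rw [assoc, this, comp_zero]
    obtain ⟨g, rfl⟩ : ∃ g, f = g ≫ q := Triangle.coyoneda_exact₃ _ hT f hfδ
    obtain ⟨n, g', hg'⟩ := exists_factor_of_mem_summandSubgroup ψ hq (hsmall k g)
    rw [hg', assoc, assoc, ← hqh, hP] at hf
    have : g' ≫ ψ n = 0 := hkill (p n) k g' hf
    rw [hg', ι_comp_eq ψ hq, reassoc_of% this, zero_comp]
  obtain ⟨Z, a, b, hZ⟩ := distinguished_cocone_triangle h
  have hZ₀ : IsZero Z := hgen Z fun k f => by
    have hfb : f ≫ b = 0 := by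
      refine eq_zero_of_comp_shift_map hinj k _ ?_
      have : b ≫ h⟦(1 : ℤ)⟧' = 0 := comp_distTriang_mor_zero₃₁ _ hZ
      rw [assoc, this, comp_zero]
    obtain ⟨g, rfl⟩ : ∃ g, f = g ≫ a := Triangle.coyoneda_exact₃ _ hZ f hfb
    obtain ⟨g', rfl⟩ := hsurj k g
    have : h ≫ a = 0 := comp_distTriang_mor_zero₁₂ _ hZ
    rw [assoc, this, comp_zero]
  exact hS.1.two_of_three₂ _ hZ hYS (hS.1.iso_closed hZ₀.isoZero.symm hS.1.zero_mem)

/-- The preimage of a localizing subcategory under an exact coproduct-preserving functor is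
localizing. -/
lemma IsLocalizing.preimage {S : Set T} (hS : IsLocalizing S) (G : T ⥤ T) [G.CommShift ℤ]
    [G.IsTriangulated] [∀ ι : Type v, PreservesColimitsOfShape (Discrete ι) G] :
    IsLocalizing {X | G.obj X ∈ S} where
  left :=
    { zero_mem := hS.1.iso_closed G.mapZeroObject.symm hS.1.zero_mem
      iso_closed := fun _ _ e h => hS.1.iso_closed (G.mapIso e) h
      two_of_three₃ := fun _ hT h h' => hS.1.two_of_three₃ _ (G.map_distinguished _ hT) h h'
      two_of_three₂ := fun _ hT h h' => hS.1.two_of_three₂ _ (G.map_distinguished _ hT) h h'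
      two_of_three₁ := fun _ hT h h' => hS.1.two_of_three₁ _ (G.map_distinguished _ hT) h h' }
  right x hx := hS.1.iso_closed (PreservesCoproduct.iso G x).symm (hS.2 _ hx)

end

/-- If the unit is compact and compactly generates `T`, then every localizing
subcategory of `T` is a tensor ideal of `T`. -/
theorem localizing_isTensorIdeal_of_unit_generator
    (h1 : IsCompactObj (𝟙_ C))
    (hgen : ∀ x : C, (∀ n : ℤ, ∀ f : ((𝟙_ C)⟦n⟧ ⟶ x), f = 0) → IsZero x)
    (A : Set C) (hloc : IsLocalizing A) :
    ∀ c ∈ A, ∀ t : C, t ⊗ c ∈ A := by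
  intro c hc t
  refine (hloc.preimage (tensorRight c)).mem_of_compact_generator ?_ h1 hgen t
  exact hloc.1.iso_closed (λ_ c).symm hc

end Paper
end

section
/- Let X be a spectral topological space. A subset E ⊆ X is *-closed (i.e., E is stable under generization and is an intersection of constructible subsets) if and only if E is an intersection of quasi-compact open subsets of X. -/
open TopologicalSpace Set

universe u u₂

namespace Paper

variable {X : Type u} [TopologicalSpace X]

/-- A subset is retrocompact if its intersection with every quasi-compact open subset is
quasi-compact. -/
def IsRetrocompact (s : Set X) : Prop :=
  ∀ U : Set X, IsOpen U → IsCompact U → IsCompact (s ∩ U)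

/-- A subset is constructible if it is a finite union of sets `U \ V` with `U`, `V`
retrocompact open subsets. -/
def IsConstructible (E : Set X) : Prop :=
  ∃ S : Finset (Set X × Set X),
    (∀ p ∈ S, IsOpen p.1 ∧ IsRetrocompact p.1 ∧ IsOpen p.2 ∧ IsRetrocompact p.2) ∧
    E = ⋃ p ∈ S, p.1 \ p.2

/-- A subset is ind-constructible (C-open) if it is a union of constructible subsets. -/
def IsUnionConstructible (E : Set X) : Prop :=
  ∃ S : Set (Set X), (∀ s ∈ S, IsConstructible s) ∧ E = ⋃₀ S

/-- A subset is pro-constructible (C-closed) if it is an intersection of constructible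
subsets. -/
def IsInterConstructible (E : Set X) : Prop :=
  ∃ S : Set (Set X), (∀ s ∈ S, IsConstructible s) ∧ E = ⋂₀ S

/-- A Thomason (`*`-open) subset: stable under specialization and a union of constructible
subsets. -/
def IsThomason (E : Set X) : Prop :=
  StableUnderSpecialization E ∧ IsUnionConstructible E

/-- A spectral space: quasi-compact, sober, and the quasi-compact open subsets form a basis
of the topology which is closed under finite intersections. -/
class SpectralSpace (X : Type u) [TopologicalSpace X] : Prop where
  compact : CompactSpace X
  quasiSober : QuasiSober X
  t0 : T0Space X
  basis_qc_opens : IsTopologicalBasis {U : Set X | IsOpen U ∧ IsCompact U}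
  inter_qc : ∀ U V : Set X, IsOpen U → IsCompact U → IsOpen V → IsCompact V →
    IsCompact (U ∩ V)

namespace SpectralSpace

variable [SpectralSpace X]

/-- A spectral space is spectral in the sense of Mathlib. -/
theorem toRootSpectralSpace : _root_.SpectralSpace X where
  t0 := (SpectralSpace.t0 (X := X)).t0
  isCompact_univ := (SpectralSpace.compact (X := X)).isCompact_univ
  sober := (SpectralSpace.quasiSober (X := X)).sober
  inter_isCompact := SpectralSpace.inter_qc
  isTopologicalBasis := SpectralSpace.basis_qc_opens

end SpectralSpace

/-- Retrocompact subsets of a quasi-compact space are quasi-compact. -/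
theorem IsRetrocompact.isCompact [CompactSpace X] {s : Set X} (hs : IsRetrocompact s) :
    IsCompact s := by
  simpa using hs univ isOpen_univ isCompact_univ

theorem IsRetrocompact.empty : IsRetrocompact (∅ : Set X) := fun U _ _ => by simp

theorem isRetrocompact_of_isCompact [QuasiSeparatedSpace X] {s : Set X} (hs : IsOpen s)
    (hc : IsCompact s) : IsRetrocompact s :=
  fun U hU hUc => QuasiSeparatedSpace.inter_isCompact s U hs hc hU hUc

theorem isConstructible_of_isCompact [QuasiSeparatedSpace X] {s : Set X} (hs : IsOpen s)
    (hc : IsCompact s) : IsConstructible s :=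
  ⟨{(s, ∅)}, by simp [hs, isRetrocompact_of_isCompact hs hc, IsRetrocompact.empty], by simp⟩

/-- Quasi-compact open subsets are clopen in the constructible topology. -/
theorem isClopen_constructibleTopology {s : Set X} (hs : IsOpen s) (hc : IsCompact s) :
    @IsClopen X (constructibleTopology X) s :=
  ⟨(@isOpen_compl_iff X s (constructibleTopology X)).1
    (IsCompact.isOpen_constructibleTopology_of_isClosed (by simpa using hc) hs.isClosed_compl),
    hc.isOpen_constructibleTopology_of_isOpen hs⟩

/-- Constructible subsets of a quasi-compact space are closed in the constructible topology. -/
theorem IsConstructible.isClosed_constructibleTopology [CompactSpace X] {s : Set X}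
    (hs : IsConstructible s) : @IsClosed X (constructibleTopology X) s := by
  obtain ⟨S, hS, rfl⟩ := hs
  refine @isClosed_biUnion_finset X _ (constructibleTopology X) _ _ fun p hp => ?_
  obtain ⟨h₁, h₁', h₂, h₂'⟩ := hS p hp
  exact (@IsClopen.diff X (constructibleTopology X) _ _
    (isClopen_constructibleTopology h₁ h₁'.isCompact)
    (isClopen_constructibleTopology h₂ h₂'.isCompact)).1

theorem IsInterConstructible.isClosed_constructibleTopology [CompactSpace X] {s : Set X}
    (hs : IsInterConstructible s) : @IsClosed X (constructibleTopology X) s := by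
  obtain ⟨S, hS, rfl⟩ := hs
  exact @isClosed_sInter X (constructibleTopology X) S
    fun t ht => (hS t ht).isClosed_constructibleTopology

/-- The constructible topology of a prespectral space refines the given topology. -/
theorem constructibleTopology_le [PrespectralSpace X] :
    constructibleTopology X ≤ ‹TopologicalSpace X› := by
  refine le_of_le_of_eq (le_generateFrom ?_)
    (PrespectralSpace.isTopologicalBasis (X := X)).eq_generateFrom.symm
  exact fun s hs => hs.2.isOpen_constructibleTopology_of_isOpen hs.1

/-- Pro-constructible subsets of a spectral space are quasi-compact. -/
theorem IsInterConstructible.isCompact [_root_.SpectralSpace X] {s : Set X}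
    (hs : IsInterConstructible s) : IsCompact s := by
  have hcont : Continuous
      (WithTopology.ofTopology : WithConstructibleTopology X → X) :=
    continuous_le_rng constructibleTopology_le (WithTopology.continuous_ofTopology _)
  have hclosed : IsClosed
      ((WithTopology.ofTopology : WithConstructibleTopology X → X) ⁻¹' s) :=
    WithConstructibleTopology.isClosed_iff.2 hs.isClosed_constructibleTopology
  simpa [image_preimage_eq s (WithTopology.ofTopology_surjective _)] using
    hclosed.isCompact.image hcont

/-- In a prespectral space, a quasi-compact subset stable under generization is an intersection of
quasi-compact open subsets. -/
theorem eq_sInter_of_stableUnderGeneralization [PrespectralSpace X] {E : Set X}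
    (hE : StableUnderGeneralization E) (hc : IsCompact E) :
    E = ⋂₀ {U | (IsOpen U ∧ IsCompact U) ∧ E ⊆ U} := by
  refine Subset.antisymm (subset_sInter fun U hU => hU.2) fun x hx => ?_
  by_contra hxE
  have hsub : E ⊆ (closure {x})ᶜ := fun e he hex =>
    hxE (hE (specializes_iff_mem_closure.2 hex) he)
  obtain ⟨W, hWc, hWo, hEW, hW⟩ :=
    PrespectralSpace.exists_isCompact_and_isOpen_between hc isClosed_closure.isOpen_compl hsub
  exact hW (hx W ⟨⟨hWo, hWc⟩, hEW⟩) (subset_closure rfl)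

/-- In a spectral space, a subset is `*`-closed (stable under generization
and pro-constructible) iff it is an intersection of quasi-compact open subsets. -/
theorem star_closed_iff_inter_qc_open [SpectralSpace X] (E : Set X) :
    (StableUnderGeneralization E ∧ IsInterConstructible E) ↔
      ∃ S : Set (Set X), (∀ s ∈ S, IsOpen s ∧ IsCompact s) ∧ E = ⋂₀ S := by
  have := SpectralSpace.toRootSpectralSpace (X := X)
  constructor
  · rintro ⟨hE, hc⟩
    exact ⟨_, fun U hU => hU.1, eq_sInter_of_stableUnderGeneralization hE hc.isCompact⟩
  · rintro ⟨S, hS, rfl⟩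
    exact ⟨stableUnderGeneralization_sInter S fun s hs => (hS s hs).1.stableUnderGeneralization,
      S, fun s hs => isConstructible_of_isCompact (hS s hs).1 (hS s hs).2, rfl⟩

end Paper
end
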